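/- (Lemma 1, candidate-set decomposition for a query on an edge.) Let O be a finite set of geo-visual objects, let O_e ⊆ O be the objects located on the edge e_{i,j} containing the query Q, and let F_Q, F_i, F_j : O → ℝ be the score functions at the query location Q and at the edge endpoints n_i and n_j respectively. Suppose there exist constants C_i ≥ 0 and C_j ≥ 0 such that (i) for every o ∈ O, F_Q(o) ≤ F_i(o) + C_i and F_Q(o) ≤ F_j(o) + C_j, and (ii) for every o ∈ O \ O_e, F_Q(o) = F_i(o) + C_i or F_Q(o) = F_j(o) + C_j. Let R be a top-k result set for F_Q, R_i a top-k result set for F_i, and R_j a top-k result set for F_j. Then R ⊆ O_e ∪ R_i ∪ R_j. -/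

import Mathlib

/-- `R` is a top-`k` result set for the score function `F` over the finite set `O`
of objects: `R ⊆ O`, `|R| = k`, and every object in `R` scores strictly better
(smaller) than every object of `O` outside `R`. -/
def IsTopK {α : Type*} [DecidableEq α] (O : Finset α) (F : α → ℝ) (k : ℕ)
    (R : Finset α) : Prop :=
  R ⊆ O ∧ R.card = k ∧ ∀ o ∈ R, ∀ o' ∈ O \ R, F o < F o'

/-- If `FQ ≤ F + C` on `O`, then an object of the top-`k` set for `FQ` at which equality holds
also belongs to the top-`k` set for `F`. -/
theorem IsTopK.mem_of_eq_add {α : Type*} [DecidableEq α] {O : Finset α} {FQ F : α → ℝ} {C : ℝ}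
    {k : ℕ} {R S : Finset α} (hR : IsTopK O FQ k R) (hS : IsTopK O F k S)
    (hle : ∀ o ∈ O, FQ o ≤ F o + C) {o : α} (ho : o ∈ R) (heq : FQ o = F o + C) : o ∈ S := by
  obtain ⟨hRO, hRk, hRlt⟩ := hR
  obtain ⟨hSO, hSk, hSlt⟩ := hS
  by_contra hoS
  have hnot : ¬ S ⊆ R := fun hsub =>
    hoS (Finset.eq_of_subset_of_card_le hsub (hRk.trans hSk.symm).le ▸ ho)
  obtain ⟨o', ho'S, ho'R⟩ := Finset.not_subset.mp hnot
  have hQ := hRlt o ho o' (Finset.mem_sdiff.mpr ⟨hSO ho'S, ho'R⟩)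
  have hF := hSlt o' ho'S o (Finset.mem_sdiff.mpr ⟨hRO ho, hoS⟩)
  linarith [hle o' (hSO ho'S)]

/-- Lemma 1 (candidate-set decomposition for a query on an edge): if the query score
is bounded by the endpoint scores plus nonnegative offsets, with equality at one of
the two endpoints for every object not on the query's edge, then every top-`k`
result for the query is contained in the union of the objects on the edge and the
top-`k` results at the two endpoints. -/
theorem stmt_8 {α : Type*} [DecidableEq α] (O Oe : Finset α) (hOe : Oe ⊆ O)
    (FQ Fi Fj : α → ℝ) (Ci Cj : ℝ) (hCi : 0 ≤ Ci) (hCj : 0 ≤ Cj)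
    (h1 : ∀ o ∈ O, FQ o ≤ Fi o + Ci ∧ FQ o ≤ Fj o + Cj)
    (h2 : ∀ o ∈ O \ Oe, FQ o = Fi o + Ci ∨ FQ o = Fj o + Cj)
    (k : ℕ) (R Ri Rj : Finset α)
    (hR : IsTopK O FQ k R) (hRi : IsTopK O Fi k Ri) (hRj : IsTopK O Fj k Rj) :
    R ⊆ Oe ∪ Ri ∪ Rj := by
  intro o ho
  by_cases hoe : o ∈ Oe
  · simp [hoe]
  rcases h2 o (Finset.mem_sdiff.mpr ⟨hR.1 ho, hoe⟩) with h | h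
  · simp [hR.mem_of_eq_add hRi (fun x hx => (h1 x hx).1) ho h]
  · simp [hR.mem_of_eq_add hRj (fun x hx => (h1 x hx).2) ho h]
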